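/- Let k be a field of characteristic p > 0, X a nonempty totally ordered set, H a Hall set in X*, and n a positive integer. Then the polynomials P(w)^{p^j} in the free associative k-algebra k⟨X⟩, where j ≥ 0 and w ∈ H satisfy |w|·p^j = n, form a k-linear basis of the degree-n homogeneous component (with respect to total degree) of the restricted Lie subalgebra of k⟨X⟩ generated by X, i.e. of the smallest k-linear subspace of k⟨X⟩ containing X that is closed under the bracket [a,b] = ab − ba and under the p-th power map a ↦ a^p. -/

import Mathlib

/-- The foliage (bracket-dropping) map from the free magma on `X` to the words over `X`. -/
def fol {X : Type*} : FreeMagma X → List X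
  | FreeMagma.of x => [x]
  | FreeMagma.mul a b => fol a ++ fol b

/-- A Hall set in the free magma `M_X` on a totally ordered set `X`: a set `H` of
non-associative words together with a total order `le` on it such that `X ⊆ H` as ordered sets,
if `h = (h' h'') ∈ H ∖ X` then `h'' ∈ H` and `h < h''`, and `h = (h' h'') ∈ M_X ∖ X` lies in `H`
iff `h', h'' ∈ H`, `h' < h''`, and either `h' ∈ X` or `h' = (h₁ h₂)` with `h₂ ≥ h''`.
The image of `H` under the foliage map is the corresponding Hall set in `X*`. -/
structure IsHallSet {X : Type*} [LinearOrder X] (H : Set (FreeMagma X))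
    (le : FreeMagma X → FreeMagma X → Prop) : Prop where
  refl : ∀ h ∈ H, le h h
  antisymm : ∀ h ∈ H, ∀ h' ∈ H, le h h' → le h' h → h = h'
  trans : ∀ a ∈ H, ∀ b ∈ H, ∀ c ∈ H, le a b → le b c → le a c
  total : ∀ a ∈ H, ∀ b ∈ H, le a b ∨ le b a
  of_mem : ∀ x : X, FreeMagma.of x ∈ H
  of_le : ∀ x y : X, le (FreeMagma.of x) (FreeMagma.of y) ↔ x ≤ y
  mul_mem_right : ∀ h' h'' : FreeMagma X, h' * h'' ∈ H →
    h'' ∈ H ∧ le (h' * h'') h'' ∧ h' * h'' ≠ h''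
  mul_mem_iff : ∀ h' h'' : FreeMagma X, h' * h'' ∈ H ↔
    (h' ∈ H ∧ h'' ∈ H ∧ le h' h'' ∧ h' ≠ h'' ∧
      ((∃ x : X, h' = FreeMagma.of x) ∨
        ∃ h₁ h₂ : FreeMagma X, h' = h₁ * h₂ ∧ le h'' h₂))

/-- `τ_h` for a non-associative word `h`: `τ_(x) = ι x` and
`τ_{(h' h'')} = [τ_{h'}, τ_{h''}] = τ_{h'}⁻¹ τ_{h''}⁻¹ τ_{h'} τ_{h''}`.  For `h` in a Hall set
`H` with foliage `w = fol h`, this is the element `τ_w` associated with the Hall word `w`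
(recursion along the standard factorization). -/
def tauM {X S : Type*} [Group S] (ι : X → S) : FreeMagma X → S
  | FreeMagma.of x => ι x
  | FreeMagma.mul a b =>
    (tauM ι a)⁻¹ * (tauM ι b)⁻¹ * tauM ι a * tauM ι b

/-- The polynomial `P(h)` in the free associative algebra `k⟨X⟩` (realized as the monoid algebra
of the free monoid on `X`): `P(x) = x` and `P((h' h'')) = [P(h'), P(h'')]`.  For `h` in a Hall
set with foliage `w`, this is the Hall polynomial `P(w)` (recursion along the standard
factorization). -/
noncomputable def Pm (k : Type*) [CommRing k] {X : Type*} :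
    FreeMagma X → MonoidAlgebra k (FreeMonoid X)
  | FreeMagma.of x => MonoidAlgebra.single (FreeMonoid.of x) 1
  | FreeMagma.mul a b => Pm k a * Pm k b - Pm k b * Pm k a

/-- The restricted Lie subalgebra of an associative `k`-algebra generated by a set `s`
(as a `k`-submodule): the smallest `k`-submodule containing `s` which is closed under the
bracket `[a, b] = a b - b a` and under the `p`-th power map `a ↦ a ^ p`. -/
def restrictedClosure (p : ℕ) (k : Type*) {A : Type*} [CommRing k] [Ring A] [Algebra k A]
    (s : Set A) : Submodule k A :=
  sInf {M : Submodule k A | s ⊆ M ∧ (∀ a ∈ M, ∀ b ∈ M, a * b - b * a ∈ M) ∧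
    ∀ a ∈ M, a ^ p ∈ M}

open scoped TensorProduct

section HallWords

variable {X : Type*}

/-- The word obtained by concatenating the foliages of a list of trees. -/
def folList (L : List (FreeMagma X)) : List X := L.flatMap fol

@[simp] lemma folList_nil : folList ([] : List (FreeMagma X)) = [] := rfl

@[simp] lemma folList_cons (h : FreeMagma X) (L : List (FreeMagma X)) :
    folList (h :: L) = fol h ++ folList L := rfl

@[simp] lemma fol_of (x : X) : fol (FreeMagma.of x) = [x] := rfl

@[simp] lemma fol_mul (a b : FreeMagma X) : fol (a * b) = fol a ++ fol b := rfl

lemma FreeMagma.mul_inj {a b c d : FreeMagma X} (h : a * b = c * d) : a = c ∧ b = d := by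
  injection h with h₁ h₂
  exact ⟨h₁, h₂⟩

lemma FreeMagma.of_ne_mul {x : X} {a b : FreeMagma X} : FreeMagma.of x ≠ a * b := by
  intro h
  injection h

/-- Nonincreasing lists of elements of `H`. -/
def IsDecHall (H : Set (FreeMagma X)) (le : FreeMagma X → FreeMagma X → Prop)
    (L : List (FreeMagma X)) : Prop :=
  (∀ h ∈ L, h ∈ H) ∧ L.Pairwise fun a b => le b a

/-- If `t = (t' t'')`, then `t''` dominates every entry of `L`. -/
def RightDominates (le : FreeMagma X → FreeMagma X → Prop) (t : FreeMagma X)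
    (L : List (FreeMagma X)) : Prop :=
  ∀ a b, t = a * b → ∀ g ∈ L, le g b

lemma rightDominates_of (le : FreeMagma X → FreeMagma X → Prop) (x : X)
    (L : List (FreeMagma X)) : RightDominates le (FreeMagma.of x) L :=
  fun _ _ h => (FreeMagma.of_ne_mul h).elim

open Classical in
/-- Insert a tree at the front of a list, bracketing as long as there is a rise. -/
noncomputable def hallInsert (le : FreeMagma X → FreeMagma X → Prop) :
    FreeMagma X → List (FreeMagma X) → List (FreeMagma X)
  | t, [] => [t]
  | t, h :: L => if le h t then t :: h :: L else hallInsert le (t * h) L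

/-- The factorization of a word into a nonincreasing sequence of Hall trees. -/
noncomputable def hallFactor (le : FreeMagma X → FreeMagma X → Prop) :
    List X → List (FreeMagma X)
  | [] => []
  | x :: w => hallInsert le (FreeMagma.of x) (hallFactor le w)

lemma folList_hallInsert (le : FreeMagma X → FreeMagma X → Prop) (t : FreeMagma X)
    (L : List (FreeMagma X)) : folList (hallInsert le t L) = fol t ++ folList L := by
  induction L generalizing t with
  | nil => simp [hallInsert]
  | cons h L ih =>
    rw [hallInsert]
    split_ifs
    · rfl
    · simp [ih]

lemma folList_hallFactor (le : FreeMagma X → FreeMagma X → Prop) (w : List X) :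
    folList (hallFactor le w) = w := by
  induction w with
  | nil => rfl
  | cons x w ih => simp [hallFactor, folList_hallInsert, ih]

lemma hallInsert_eq_cons {le : FreeMagma X → FreeMagma X → Prop} {t : FreeMagma X}
    {L : List (FreeMagma X)} (h : ∀ g ∈ L, le g t) : hallInsert le t L = t :: L := by
  cases L with
  | nil => rfl
  | cons g L => rw [hallInsert, if_pos (h g (by simp))]

variable {H : Set (FreeMagma X)} {le : FreeMagma X → FreeMagma X → Prop}

lemma IsDecHall.tail {h : FreeMagma X} {L : List (FreeMagma X)} (hL : IsDecHall H le (h :: L)) :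
    IsDecHall H le L :=
  ⟨fun g hg => hL.1 g (List.mem_cons_of_mem _ hg), (List.pairwise_cons.1 hL.2).2⟩

lemma IsDecHall.head_mem {h : FreeMagma X} {L : List (FreeMagma X)}
    (hL : IsDecHall H le (h :: L)) : h ∈ H := hL.1 h (by simp)

lemma IsDecHall.le_head {h : FreeMagma X} {L : List (FreeMagma X)}
    (hL : IsDecHall H le (h :: L)) : ∀ g ∈ L, le g h := (List.pairwise_cons.1 hL.2).1

lemma IsDecHall.cons {h : FreeMagma X} {L : List (FreeMagma X)} (hL : IsDecHall H le L)
    (hh : h ∈ H) (hle : ∀ g ∈ L, le g h) : IsDecHall H le (h :: L) :=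
  ⟨by simpa [hh] using hL.1, List.pairwise_cons.2 ⟨hle, hL.2⟩⟩

lemma isDecHall_nil : IsDecHall H le [] := by simp [IsDecHall]

lemma IsDecHall.sublist {L L' : List (FreeMagma X)} (hL : IsDecHall H le L)
    (h : L'.Sublist L) : IsDecHall H le L' :=
  ⟨fun g hg => hL.1 g (h.subset hg), hL.2.sublist h⟩

lemma IsDecHall.rightDominates_mul {h : FreeMagma X} {L : List (FreeMagma X)}
    (hL : IsDecHall H le (h :: L)) (t : FreeMagma X) : RightDominates le (t * h) L := by
  intro a b hab g hg
  rw [← (FreeMagma.mul_inj hab).2]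
  exact hL.le_head g hg

variable [LinearOrder X]

lemma IsHallSet.le_of_not_le (hH : IsHallSet H le) {a b : FreeMagma X} (ha : a ∈ H) (hb : b ∈ H)
    (h : ¬ le b a) : le a b := (hH.total a ha b hb).resolve_right h

lemma IsHallSet.mul_mem (hH : IsHallSet H le) {t h : FreeMagma X} {L : List (FreeMagma X)}
    (ht : t ∈ H) (hh : h ∈ H) (hlt : ¬ le h t) (hd : RightDominates le t (h :: L)) :
    t * h ∈ H := by
  refine (hH.mul_mem_iff t h).2 ⟨ht, hh, hH.le_of_not_le ht hh hlt, ?_, ?_⟩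
  · rintro rfl
    exact hlt (hH.refl t ht)
  · induction t using FreeMagma.recOnMul with
    | ih1 x => exact Or.inl ⟨x, rfl⟩
    | ih2 a b _ _ => exact Or.inr ⟨a, b, rfl, hd a b rfl h (by simp)⟩

lemma IsHallSet.isDecHall_hallInsert (hH : IsHallSet H le) {t : FreeMagma X}
    {L : List (FreeMagma X)} (ht : t ∈ H) (hL : IsDecHall H le L)
    (hd : RightDominates le t L) : IsDecHall H le (hallInsert le t L) := by
  induction L generalizing t with
  | nil => exact hL.cons ht (by simp)
  | cons h L ih =>
    rw [hallInsert]
    split_ifs with hle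
    · refine hL.cons ht fun g hg => ?_
      rcases List.mem_cons.1 hg with rfl | hg'
      · exact hle
      · exact hH.trans g (hL.1 g hg) h hL.head_mem t ht (hL.le_head g hg') hle
    · exact ih (hH.mul_mem ht hL.head_mem hle hd) hL.tail (hL.rightDominates_mul t)

lemma IsHallSet.isDecHall_hallFactor (hH : IsHallSet H le) (w : List X) :
    IsDecHall H le (hallFactor le w) := by
  induction w with
  | nil => exact isDecHall_nil
  | cons x w ih => exact hH.isDecHall_hallInsert (hH.of_mem x) ih (rightDominates_of le x _)

lemma IsHallSet.exists_hallInsert_of_eq (hH : IsHallSet H le) (t : FreeMagma X)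
    {L : List (FreeMagma X)} (ht : t ∈ H) (hL : IsDecHall H le L) (hd : RightDominates le t L) :
    ∃ x L', IsDecHall H le L' ∧ fol t ++ folList L = x :: folList L' ∧
      hallInsert le t L = hallInsert le (FreeMagma.of x) L' := by
  induction t using FreeMagma.recOnMul generalizing L with
  | ih1 x => exact ⟨x, L, hL, rfl, rfl⟩
  | ih2 a b iha _ =>
    obtain ⟨ha, hb, hab, hne, hd'⟩ := (hH.mul_mem_iff a b).1 ht
    have hLb := hd a b rfl
    have hbL : IsDecHall H le (b :: L) := hL.cons hb hLb
    have had : RightDominates le a (b :: L) := by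
      intro c d hcd g hg
      obtain ⟨x, rfl⟩ | ⟨c', d', hcd', hbd⟩ := hd'
      · exact (FreeMagma.of_ne_mul hcd).elim
      obtain ⟨rfl, rfl⟩ := FreeMagma.mul_inj (hcd'.symm.trans hcd)
      have hdH := (hH.mul_mem_right c' d' (hcd ▸ ha)).1
      rcases List.mem_cons.1 hg with rfl | hg'
      · exact hbd
      · exact hH.trans g (hbL.1 g hg) b hb d' hdH (hLb g hg') hbd
    obtain ⟨x, L', hL', hf, hi⟩ := iha ha hbL had
    refine ⟨x, L', hL', by simpa using hf, ?_⟩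
    rw [← hi, hallInsert, if_neg fun hba => hne (hH.antisymm a ha b hb hab hba)]

lemma IsHallSet.rightDominates_of_isDecHall (hH : IsHallSet H le) {h : FreeMagma X}
    {L : List (FreeMagma X)} (hL : IsDecHall H le (h :: L)) : RightDominates le h L := by
  rintro a b rfl g hg
  obtain ⟨hb, hle, -⟩ := hH.mul_mem_right a b hL.head_mem
  exact hH.trans g (hL.tail.1 g hg) _ hL.head_mem b hb (hL.le_head g hg) hle

/-- Uniqueness of the factorization of a word into a nonincreasing sequence of Hall trees. -/
lemma IsHallSet.hallFactor_folList (hH : IsHallSet H le) {L : List (FreeMagma X)}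
    (hL : IsDecHall H le L) : hallFactor le (folList L) = L := by
  obtain ⟨w, hw⟩ : ∃ w, w = folList L := ⟨_, rfl⟩
  rw [← hw]
  induction w generalizing L with
  | nil =>
    cases L with
    | nil => rfl
    | cons h L =>
      obtain ⟨x, L', -, hf, -⟩ := hH.exists_hallInsert_of_eq h hL.head_mem hL.tail
        (hH.rightDominates_of_isDecHall hL)
      simp [hf] at hw
  | cons y w ih =>
    cases L with
    | nil => simp at hw
    | cons h L =>
      obtain ⟨x, L', hL', hf, hi⟩ := hH.exists_hallInsert_of_eq h hL.head_mem hL.tail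
        (hH.rightDominates_of_isDecHall hL)
      rw [folList_cons, hf, List.cons.injEq] at hw
      rw [hallFactor, ih hL' hw.2, hw.1, ← hi, hallInsert_eq_cons hL.le_head]

end HallWords

section HallBasis

variable {X : Type*} (k : Type*) [Field k]

/-- The product of the Hall polynomials of a list of trees. -/
noncomputable def prodPm (L : List (FreeMagma X)) : MonoidAlgebra k (FreeMonoid X) :=
  (L.map (Pm k)).prod

@[simp] lemma prodPm_nil : prodPm k ([] : List (FreeMagma X)) = 1 := rfl

@[simp] lemma prodPm_cons (h : FreeMagma X) (L : List (FreeMagma X)) :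
    prodPm k (h :: L) = Pm k h * prodPm k L := by simp [prodPm]

lemma Pm_mul (a b : FreeMagma X) : Pm k (a * b) = Pm k a * Pm k b - Pm k b * Pm k a := rfl

lemma prodPm_replicate (m : ℕ) (h : FreeMagma X) :
    prodPm k (List.replicate m h) = Pm k h ^ m := by simp [prodPm]

/-- A word, seen as an element of the free associative algebra. -/
noncomputable def word (w : List X) : MonoidAlgebra k (FreeMonoid X) :=
  MonoidAlgebra.single (FreeMonoid.ofList w) 1

lemma word_append (u v : List X) : word k (u ++ v) = word k u * word k v := by
  simp [word, MonoidAlgebra.single_mul_single]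

lemma Pm_of (x : X) : Pm k (FreeMagma.of x) = word k [x] := rfl

lemma word_nil : word k ([] : List X) = 1 := rfl

lemma linearIndependent_word : LinearIndependent k (word k : List X → _) :=
  (MonoidAlgebra.basis (FreeMonoid X) k).linearIndependent.comp _ FreeMonoid.ofList.injective

lemma span_word : Submodule.span k (Set.range (word k : List X → _)) = ⊤ := by
  rw [← (MonoidAlgebra.basis (FreeMonoid X) k).span_eq]
  exact congrArg _ (FreeMonoid.ofList.surjective.range_comp (MonoidAlgebra.basis (FreeMonoid X) k))

lemma mul_mem_span_of_mem_span {A : Type*} [Ring A] [Algebra k A] {s : Set A} {M : Submodule k A}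
    (a : A) (h : ∀ b ∈ s, a * b ∈ M) {b : A} (hb : b ∈ Submodule.span k s) : a * b ∈ M := by
  have : Submodule.span k s ≤ M.comap (LinearMap.mulLeft k a) := Submodule.span_le.2 h
  exact this hb

variable [LinearOrder X] {H : Set (FreeMagma X)} {le : FreeMagma X → FreeMagma X → Prop}

lemma IsHallSet.Pm_mul_prodPm_mem_span (hH : IsHallSet H le) {t : FreeMagma X}
    {L : List (FreeMagma X)} (Q : FreeMagma X → Prop)
    (hQ : ∀ a b, a * b ∈ H → Q b → Q (a * b)) (ht : t ∈ H) (htQ : Q t)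
    (hL : IsDecHall H le L) (hLQ : ∀ g ∈ L, Q g) (hd : RightDominates le t L) :
    Pm k t * prodPm k L ∈ Submodule.span k (prodPm k '' {L' | IsDecHall H le L' ∧
      (∀ g ∈ L', Q g) ∧ (folList L').Perm (fol t ++ folList L)}) := by
  induction L generalizing t Q with
  | nil =>
    refine Submodule.subset_span ⟨[t], ⟨hL.cons ht (by simp), by simpa using htQ, by simp⟩, ?_⟩
    simp
  | cons h L ih =>
    by_cases hle : le h t
    · refine Submodule.subset_span ⟨t :: h :: L, ⟨hL.cons ht fun g hg => ?_, ?_, by simp⟩, by simp⟩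
      · rcases List.mem_cons.1 hg with rfl | hg'
        · exact hle
        · exact hH.trans g (hL.1 g hg) h hL.head_mem t ht (hL.le_head g hg') hle
      · simpa [htQ] using hLQ
    · have hth := hH.mul_mem ht hL.head_mem hle hd
      have hhQ : Q h := hLQ h (by simp)
      have key : Pm k t * prodPm k (h :: L) =
          Pm k (t * h) * prodPm k L + Pm k h * (Pm k t * prodPm k L) := by
        rw [prodPm_cons, Pm_mul]
        noncomm_ring
      rw [key]
      refine Submodule.add_mem _ ?_ ?_
      · simpa using ih Q hQ hth (hQ t h hth hhQ) hL.tail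
          (fun g hg => hLQ g (List.mem_cons_of_mem _ hg)) (hL.rightDominates_mul t)
      · have h2 := ih (fun g => Q g ∧ le g h) (t := t)
          (fun a b hab hb => by
            obtain ⟨hb', hle', -⟩ := hH.mul_mem_right a b hab
            exact ⟨hQ a b hab hb.1, hH.trans _ hab b hb' h hL.head_mem hle' hb.2⟩) ht
          ⟨htQ, hH.le_of_not_le ht hL.head_mem hle⟩ hL.tail
          (fun g hg => ⟨hLQ g (List.mem_cons_of_mem _ hg), hL.le_head g hg⟩)
          (fun a b hab g hg => hd a b hab g (List.mem_cons_of_mem _ hg))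
        refine mul_mem_span_of_mem_span k (Pm k h) ?_ h2
        rintro _ ⟨L', ⟨hL', hLQ', hp⟩, rfl⟩
        refine Submodule.subset_span ⟨h :: L', ⟨hL'.cons hL.head_mem fun g hg => (hLQ' g hg).2,
          ?_, ?_⟩, by simp⟩
        · simpa [hhQ] using fun g hg => (hLQ' g hg).1
        · rw [folList_cons, folList_cons]
          exact (hp.append_left _).trans (List.perm_append_comm_assoc _ _ _)

lemma IsHallSet.word_mem_span (hH : IsHallSet H le) (w : List X) :
    word k w ∈ Submodule.span k (prodPm k '' {L | IsDecHall H le L ∧ (folList L).Perm w}) := by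
  induction w with
  | nil =>
    exact Submodule.subset_span ⟨[], ⟨isDecHall_nil, List.Perm.refl _⟩, (word_nil k).symm⟩
  | cons x w ih =>
    rw [← List.singleton_append, word_append, ← Pm_of]
    refine mul_mem_span_of_mem_span k (Pm k (FreeMagma.of x)) ?_ ih
    rintro _ ⟨L, ⟨hL, hp⟩, rfl⟩
    refine Submodule.span_mono (Set.image_mono ?_) (hH.Pm_mul_prodPm_mem_span k (fun _ => True)
      (fun _ _ _ _ => trivial) (hH.of_mem x) trivial hL (fun _ _ => trivial)
      (rightDominates_of le x L))
    rintro L' ⟨hL', -, hp'⟩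
    exact ⟨hL', hp'.trans (hp.append_left _)⟩

lemma IsHallSet.word_mem_span_hallFactor (hH : IsHallSet H le) (w : List X) :
    word k w ∈ Submodule.span k ((fun v => prodPm k (hallFactor le v)) '' {v | v.Perm w}) := by
  refine Submodule.span_mono ?_ (hH.word_mem_span k w)
  rintro _ ⟨L, ⟨hL, hp⟩, rfl⟩
  exact ⟨folList L, hp, by simp [hH.hallFactor_folList hL]⟩

lemma IsHallSet.linearIndependent_prodPm (hH : IsHallSet H le) :
    LinearIndependent k fun w : List X => prodPm k (hallFactor le w) := by
  rw [linearIndependent_iff_finset_linearIndependent]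
  intro s
  let F : Finset (List X) := s.biUnion fun w => w.permutations.toFinset
  have hsF : ∀ w ∈ s, w ∈ F := fun w hw => by
    simp only [F, Finset.mem_biUnion, List.mem_toFinset, List.mem_permutations]
    exact ⟨w, hw, List.Perm.refl w⟩
  suffices hF : LinearIndependent k fun w : F => prodPm k (hallFactor le w.1) from
    hF.comp (fun w : s => (⟨w.1, hsF w.1 w.2⟩ : F)) fun a b hab => Subtype.ext
      (congrArg (fun z : F => z.1) hab)
  rw [linearIndependent_iff_card_le_finrank_span]
  have hw : LinearIndependent k fun w : F => word k w.1 :=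
    (linearIndependent_word k).comp _ Subtype.val_injective
  rw [← finrank_span_eq_card hw, Set.finrank]
  have := FiniteDimensional.span_of_finite k
    (Set.finite_range fun w : F => prodPm k (hallFactor le w.1))
  refine Submodule.finrank_mono (Submodule.span_le.2 ?_)
  rintro _ ⟨w, rfl⟩
  refine Submodule.span_mono ?_ (hH.word_mem_span_hallFactor k w.1)
  rintro _ ⟨v, hv, rfl⟩
  refine ⟨⟨v, ?_⟩, rfl⟩
  have hwF := w.2
  simp only [F, Finset.mem_biUnion, List.mem_toFinset, List.mem_permutations] at hwF ⊢
  obtain ⟨u, hu, huw⟩ := hwF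
  exact ⟨u, hu, List.Perm.trans hv huw⟩

/-- The Poincaré–Birkhoff–Witt basis of nonincreasing products of Hall polynomials, indexed by
words through their factorization into Hall words. -/
noncomputable def IsHallSet.basis (hH : IsHallSet H le) :
    Module.Basis (List X) k (MonoidAlgebra k (FreeMonoid X)) :=
  Module.Basis.mk (hH.linearIndependent_prodPm k) <| by
    rw [← span_word, Submodule.span_le]
    rintro _ ⟨w, rfl⟩
    exact Submodule.span_mono (Set.image_subset_range _ _) (hH.word_mem_span_hallFactor k w)

lemma IsHallSet.basis_apply (hH : IsHallSet H le) (w : List X) :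
    hH.basis k w = prodPm k (hallFactor le w) := Module.Basis.mk_apply _ _ w

lemma IsHallSet.basis_folList (hH : IsHallSet H le) {L : List (FreeMagma X)}
    (hL : IsDecHall H le L) : hH.basis k (folList L) = prodPm k L := by
  rw [hH.basis_apply k, hH.hallFactor_folList hL]

lemma IsHallSet.folList_injOn (hH : IsHallSet H le) {L L' : List (FreeMagma X)}
    (hL : IsDecHall H le L) (hL' : IsDecHall H le L') (h : folList L = folList L') : L = L' := by
  rw [← hH.hallFactor_folList hL, h, hH.hallFactor_folList hL']

end HallBasis

section Splits

variable {α : Type*}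

/-- All ways of distributing the entries of a list over two complementary sublists. -/
def splits : List α → List (List α × List α)
  | [] => [([], [])]
  | h :: L => (splits L).map (fun q => (h :: q.1, q.2)) ++ (splits L).map fun q => (q.1, h :: q.2)

lemma sublist_of_mem_splits {L : List α} {q : List α × List α} (hq : q ∈ splits L) :
    q.1.Sublist L ∧ q.2.Sublist L ∧ (q.1 ++ q.2).Perm L := by
  induction L generalizing q with
  | nil =>
    obtain rfl : q = ([], []) := by simpa [splits] using hq
    simp
  | cons h L ih =>
    rw [splits, List.mem_append, List.mem_map, List.mem_map] at hq
    rcases hq with ⟨r, hr, rfl⟩ | ⟨r, hr, rfl⟩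
    · obtain ⟨h₁, h₂, h₃⟩ := ih hr
      exact ⟨h₁.cons_cons h, h₂.cons h, h₃.cons h⟩
    · obtain ⟨h₁, h₂, h₃⟩ := ih hr
      exact ⟨h₁.cons h, h₂.cons_cons h, List.perm_middle.trans (h₃.cons h)⟩

variable [DecidableEq α]

lemma count_splits_cons (h : α) (L a b : List α) :
    (splits (h :: L)).count (a, b) =
      (if a.head? = some h then (splits L).count (a.tail, b) else 0) +
        if b.head? = some h then (splits L).count (a, b.tail) else 0 := by
  rw [splits, List.count_append]
  congr 1
  · split_ifs with ha
    · obtain ⟨c, rfl⟩ : ∃ c, a = h :: c := List.head?_eq_some_iff.1 ha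
      exact List.count_map_of_injective (splits L) (fun q => (h :: q.1, q.2))
        (fun q r hqr => by simpa [Prod.ext_iff] using hqr) (c, b)
    · rw [List.count_eq_zero, List.mem_map]
      rintro ⟨q, -, hq⟩
      simp only [Prod.mk.injEq] at hq
      simp [← hq.1] at ha
  · split_ifs with hb
    · obtain ⟨c, rfl⟩ : ∃ c, b = h :: c := List.head?_eq_some_iff.1 hb
      exact List.count_map_of_injective (splits L) (fun q => (q.1, h :: q.2))
        (fun q r hqr => by simpa [Prod.ext_iff] using hqr) (a, c)
    · rw [List.count_eq_zero, List.mem_map]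
      rintro ⟨q, -, hq⟩
      simp only [Prod.mk.injEq] at hq
      simp [← hq.2] at hb

lemma count_splits_nil_left (b : List α) : (splits b).count ([], b) = 1 := by
  induction b with
  | nil => simp [splits]
  | cons h b ih => simp [count_splits_cons, ih]

lemma count_splits_replicate_append (h : α) (m : ℕ) {b : List α} (hb : h ∉ b) :
    (splits (List.replicate m h ++ b)).count (List.replicate m h, b) = 1 := by
  induction m with
  | zero => simpa using count_splits_nil_left b
  | succ m ih =>
    have hb' : b.head? ≠ some h := fun e => hb (List.mem_of_head? e)
    simp [List.replicate_succ, count_splits_cons, ih, hb']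

lemma count_splits_replicate (h : α) (i j : ℕ) :
    (splits (List.replicate (i + j) h)).count (List.replicate i h, List.replicate j h) =
      (i + j).choose i := by
  obtain ⟨m, hm⟩ : ∃ m, m = i + j := ⟨_, rfl⟩
  rw [← hm]
  induction m generalizing i j with
  | zero =>
    obtain ⟨rfl, rfl⟩ : i = 0 ∧ j = 0 := by omega
    simp [splits]
  | succ m ih =>
    rw [List.replicate_succ, count_splits_cons]
    cases i with
    | zero =>
      obtain rfl : j = m + 1 := by omega
      simp [List.replicate_succ, count_splits_nil_left]
    | succ i =>
      cases j with
      | zero =>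
        obtain rfl : i = m := by omega
        simpa [List.replicate_succ] using ih i 0 rfl
      | succ j =>
        have h₁ := ih i (j + 1) (by omega)
        have h₂ := ih (i + 1) j (by omega)
        rw [List.replicate_succ] at h₁ h₂
        simp [List.replicate_succ, h₁, h₂, Nat.choose_succ_succ]

end Splits

lemma Nat.exists_not_dvd_choose {p : ℕ} (hp : p.Prime) {m : ℕ} (hm : m ≠ 0)
    (hpow : ∀ j, m ≠ p ^ j) : ∃ i, 0 < i ∧ i < m ∧ ¬ p ∣ m.choose i := by
  induction m using Nat.strong_induction_on with
  | _ m ih =>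
    have := Fact.mk hp
    by_cases hd : p ∣ m
    · obtain ⟨c, rfl⟩ := hd
      have hc : c ≠ 0 := right_ne_zero_of_mul hm
      obtain ⟨i, hi, hic, hch⟩ := ih c
        (lt_mul_of_one_lt_left (Nat.pos_of_ne_zero hc) hp.one_lt) hc
        fun j hj => hpow (j + 1) (by rw [hj, pow_succ'])
      refine ⟨p * i, Nat.mul_pos hp.pos hi, Nat.mul_lt_mul_of_pos_left hic hp.pos, ?_⟩
      have hl := Choose.choose_modEq_choose_mod_mul_choose_div_nat (n := p * c) (k := p * i) (p := p)
      simp only [Nat.mul_mod_right, Nat.choose_self, one_mul, Nat.mul_div_cancel_left _ hp.pos] at hl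
      rwa [hl.dvd_iff dvd_rfl]
    · exact ⟨1, one_pos, by have := hpow 0; rw [pow_zero] at this; omega, by rwa [Nat.choose_one_right]⟩

section Primitive

variable {X : Type*} (k : Type*) [Field k]

/-- The comultiplication of the free associative algebra for which the letters are primitive. -/
noncomputable def freeComul : MonoidAlgebra k (FreeMonoid X) →ₐ[k]
    MonoidAlgebra k (FreeMonoid X) ⊗[k] MonoidAlgebra k (FreeMonoid X) :=
  MonoidAlgebra.lift k _ (FreeMonoid X) <| FreeMonoid.lift fun x =>
    Pm k (FreeMagma.of x) ⊗ₜ[k] 1 + 1 ⊗ₜ[k] Pm k (FreeMagma.of x)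

/-- The primitive elements of the free associative algebra. -/
noncomputable def primitives : Submodule k (MonoidAlgebra k (FreeMonoid X)) :=
  LinearMap.eqLocus (freeComul k).toLinearMap
    (Algebra.TensorProduct.includeLeft.toLinearMap +
      Algebra.TensorProduct.includeRight.toLinearMap)

variable {k}

lemma mem_primitives {u : MonoidAlgebra k (FreeMonoid X)} :
    u ∈ primitives k ↔ freeComul k u = u ⊗ₜ[k] 1 + 1 ⊗ₜ[k] u := Iff.rfl

lemma Pm_of_mem_primitives (x : X) : Pm k (FreeMagma.of x) ∈ primitives k := by
  rw [mem_primitives]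
  conv_lhs => rw [Pm, freeComul, MonoidAlgebra.lift_single, FreeMonoid.lift_eval_of, one_smul]

lemma commutator_mem_primitives {u v : MonoidAlgebra k (FreeMonoid X)} (hu : u ∈ primitives k)
    (hv : v ∈ primitives k) : u * v - v * u ∈ primitives k := by
  rw [mem_primitives] at *
  simp only [map_sub, map_mul, hu, hv, mul_add, add_mul, Algebra.TensorProduct.tmul_mul_tmul,
    mul_one, one_mul, TensorProduct.sub_tmul, TensorProduct.tmul_sub]
  abel

lemma pow_mem_primitives {p : ℕ} [CharP k p] (hp : p.Prime) {u : MonoidAlgebra k (FreeMonoid X)}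
    (hu : u ∈ primitives k) : u ^ p ∈ primitives k := by
  rw [mem_primitives] at *
  have hc : Commute (u ⊗ₜ[k] (1 : MonoidAlgebra k (FreeMonoid X))) (1 ⊗ₜ[k] u) := by
    simp [Commute, SemiconjBy]
  have h0 : (p : MonoidAlgebra k (FreeMonoid X) ⊗[k] MonoidAlgebra k (FreeMonoid X)) = 0 := by
    rw [← map_natCast (algebraMap k _), CharP.cast_eq_zero, map_zero]
  rw [map_pow, hu, hc.add_pow_prime_eq hp, h0]
  simp [Algebra.TensorProduct.tmul_pow]

lemma Pm_mem_primitives (h : FreeMagma X) : Pm k h ∈ primitives k := by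
  induction h using FreeMagma.recOnMul with
  | ih1 x => exact Pm_of_mem_primitives x
  | ih2 a b ha hb => exact commutator_mem_primitives ha hb

lemma restrictedClosure_le_primitives {p : ℕ} [CharP k p] (hp : p.Prime) :
    restrictedClosure p k (Set.range fun x : X => (MonoidAlgebra.single (FreeMonoid.of x) 1 :
      MonoidAlgebra k (FreeMonoid X))) ≤ primitives k := by
  refine sInf_le ⟨?_, fun a ha b hb => commutator_mem_primitives ha hb,
    fun a ha => pow_mem_primitives hp ha⟩
  rintro _ ⟨x, rfl⟩
  exact Pm_of_mem_primitives x

lemma freeComul_prodPm (L : List (FreeMagma X)) : freeComul k (prodPm k L) =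
    ((splits L).map fun q => prodPm k q.1 ⊗ₜ[k] prodPm k q.2).sum := by
  induction L with
  | nil => simp [splits, Algebra.TensorProduct.one_def]
  | cons h L ih =>
    rw [prodPm_cons, map_mul, ih, mem_primitives.1 (Pm_mem_primitives h), splits, List.map_append,
      List.sum_append, add_mul, ← List.sum_map_mul_left, ← List.sum_map_mul_left]
    simp [Function.comp_def, Algebra.TensorProduct.tmul_mul_tmul]

end Primitive

section Homogeneous

variable {X : Type*} (k : Type*) [Field k]

lemma word_mul_mem_span {m n : ℕ} {u v : MonoidAlgebra k (FreeMonoid X)}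
    (hu : u ∈ Submodule.span k (word k '' {w | w.length = m}))
    (hv : v ∈ Submodule.span k (word k '' {w | w.length = n})) :
    u * v ∈ Submodule.span k (word k '' {w | w.length = m + n}) := by
  have h := Submodule.mul_mem_mul hu hv
  rw [Submodule.span_mul_span] at h
  refine Submodule.span_mono ?_ h
  rintro _ ⟨_, ⟨a, ha, rfl⟩, _, ⟨b, hb, rfl⟩, rfl⟩
  exact ⟨a ++ b, by simp_all, word_append k a b⟩

lemma Pm_mem_span_word (h : FreeMagma X) :
    Pm k h ∈ Submodule.span k (word k '' {w | w.length = (fol h).length}) := by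
  induction h using FreeMagma.recOnMul with
  | ih1 x => exact Submodule.subset_span ⟨[x], rfl, rfl⟩
  | ih2 a b ha hb =>
    rw [Pm_mul, fol_mul, List.length_append]
    refine Submodule.sub_mem _ (word_mul_mem_span k ha hb) ?_
    rw [add_comm]
    exact word_mul_mem_span k hb ha

lemma Pm_pow_mem_span_word (h : FreeMagma X) (m : ℕ) :
    Pm k h ^ m ∈ Submodule.span k (word k '' {w | w.length = (fol h).length * m}) := by
  induction m with
  | zero => exact Submodule.subset_span ⟨[], rfl, by rw [word_nil, pow_zero]⟩
  | succ m ih =>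
    rw [pow_succ, Nat.mul_succ]
    exact word_mul_mem_span k ih (Pm_mem_span_word k h)

lemma Pm_pow_mem_restrictedClosure (p : ℕ) (h : FreeMagma X) (j : ℕ) :
    Pm k h ^ p ^ j ∈ restrictedClosure p k (Set.range fun x : X =>
      (MonoidAlgebra.single (FreeMonoid.of x) 1 : MonoidAlgebra k (FreeMonoid X))) := by
  rw [restrictedClosure, Submodule.mem_sInf]
  rintro M ⟨hX, hbr, hpow⟩
  have hP : Pm k h ∈ M := by
    induction h using FreeMagma.recOnMul with
    | ih1 x => exact hX ⟨x, rfl⟩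
    | ih2 a b ha hb => exact hbr _ ha _ hb
  induction j with
  | zero => simpa using hP
  | succ j ih =>
    rw [pow_succ, pow_mul]
    exact hpow _ ih

end Homogeneous

section HallPrimitive

variable {X : Type*} [LinearOrder X] {k : Type*} [Field k] {H : Set (FreeMagma X)}
  {le : FreeMagma X → FreeMagma X → Prop}

lemma IsHallSet.coord_prodPm [DecidableEq (FreeMagma X)] (hH : IsHallSet H le)
    {a s : List (FreeMagma X)} (ha : IsDecHall H le a) (hs : IsDecHall H le s) :
    (hH.basis k).coord (folList a) (prodPm k s) = if s = a then 1 else 0 := by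
  rw [← hH.basis_folList k hs, Module.Basis.coord_apply, Module.Basis.repr_self,
    Finsupp.single_apply]
  exact if_congr ⟨hH.folList_injOn hs ha, fun h => h ▸ rfl⟩ rfl rfl

lemma IsHallSet.coord_freeComul_prodPm [DecidableEq (FreeMagma X)] (hH : IsHallSet H le)
    {a b L : List (FreeMagma X)} (ha : IsDecHall H le a) (hb : IsDecHall H le b)
    (hL : IsDecHall H le L) :
    LinearMap.mul' k k (TensorProduct.map ((hH.basis k).coord (folList a))
      ((hH.basis k).coord (folList b)) (freeComul k (prodPm k L))) =
      ((splits L).count (a, b) : k) := by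
  rw [freeComul_prodPm, map_list_sum, map_list_sum, List.map_map, List.map_map]
  have key : ∀ S : List (List (FreeMagma X) × List (FreeMagma X)),
      (S.map fun q => if q = (a, b) then (1 : k) else 0).sum = (S.count (a, b) : k) := by
    intro S
    induction S with
    | nil => simp
    | cons q S ih => simp_all [List.count_cons, add_comm]
  rw [← key (splits L)]
  congr 1
  refine List.map_congr_left fun q hq => ?_
  obtain ⟨h₁, h₂, -⟩ := sublist_of_mem_splits hq
  rw [Function.comp_apply, Function.comp_apply, TensorProduct.map_tmul, LinearMap.mul'_apply,
    hH.coord_prodPm ha (hL.sublist h₁), hH.coord_prodPm hb (hL.sublist h₂)]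
  simp only [Prod.ext_iff, ite_and]
  split_ifs <;> simp

/-- A nonempty nonincreasing list that is splittable with nonzero multiplicity does not occur in
a primitive element. -/
lemma IsHallSet.coord_eq_zero_of_count_ne_zero [DecidableEq (FreeMagma X)] (hH : IsHallSet H le)
    {a b L : List (FreeMagma X)} (hL : IsDecHall H le L) (ha : a ≠ []) (hb : b ≠ [])
    (hc : ((splits L).count (a, b) : k) ≠ 0) {u : MonoidAlgebra k (FreeMonoid X)}
    (hu : u ∈ primitives k) : (hH.basis k).coord (folList L) u = 0 := by
  have hmem : (a, b) ∈ splits L := by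
    by_contra h
    exact hc (by rw [List.count_eq_zero_of_not_mem h, Nat.cast_zero])
  obtain ⟨h₁, h₂, h₃⟩ := sublist_of_mem_splits hmem
  have ha' : IsDecHall H le a := hL.sublist h₁
  have hb' : IsDecHall H le b := hL.sublist h₂
  have hψ : LinearMap.mul' k k ∘ₗ TensorProduct.map ((hH.basis k).coord (folList a))
      ((hH.basis k).coord (folList b)) ∘ₗ (freeComul k).toLinearMap =
      ((splits L).count (a, b) : k) • (hH.basis k).coord (folList L) := by
    refine (hH.basis k).ext fun w => ?_
    have hw := hH.isDecHall_hallFactor w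
    have e := hH.coord_freeComul_prodPm (k := k) ha' hb' hw
    rw [← hH.basis_apply k] at e
    refine e.trans ?_
    rw [LinearMap.smul_apply, hH.basis_apply k, hH.coord_prodPm hL hw]
    split_ifs with hwL
    · simp [hwL]
    · rw [List.count_eq_zero_of_not_mem, Nat.cast_zero, smul_zero]
      intro hmem'
      refine hwL (List.Perm.eq_of_pairwise (le := fun a b => le b a) (fun x y hx hy hyx hxy => ?_)
        hw.2 hL.2 ((sublist_of_mem_splits hmem').2.2.symm.trans h₃))
      exact hH.antisymm x (hw.1 x hx) y (hL.1 y hy) hxy hyx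
  have h1 : ∀ c : List (FreeMagma X), IsDecHall H le c → c ≠ [] →
      (hH.basis k).coord (folList c) 1 = 0 := fun c hc hne => by
    rw [← prodPm_nil, hH.coord_prodPm hc isDecHall_nil, if_neg hne.symm]
  have e := LinearMap.congr_fun hψ u
  rw [LinearMap.comp_apply, LinearMap.comp_apply, AlgHom.toLinearMap_apply, mem_primitives.1 hu,
    map_add, TensorProduct.map_tmul, TensorProduct.map_tmul, h1 a ha' ha, h1 b hb' hb] at e
  simpa [hc] using e

lemma IsHallSet.exists_eq_replicate_append (hH : IsHallSet H le) {h : FreeMagma X} (hh : h ∈ H)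
    {L : List (FreeMagma X)} (hL : IsDecHall H le L) (hle : ∀ g ∈ L, le g h) :
    ∃ m b, L = List.replicate m h ++ b ∧ h ∉ b := by
  induction L with
  | nil => exact ⟨0, [], by simp⟩
  | cons g L ih =>
    by_cases hg : g = h
    · obtain ⟨m, b, hm, hb⟩ := ih hL.tail fun f hf => hle f (List.mem_cons_of_mem _ hf)
      exact ⟨m + 1, b, by rw [hg, hm, List.replicate_succ, List.cons_append], hb⟩
    · refine ⟨0, g :: L, by simp, fun hmem => ?_⟩
      rcases List.mem_cons.1 hmem with rfl | hmem
      · exact hg rfl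
      · exact hg (hH.antisymm g hL.head_mem h hh (hle g (by simp)) (hL.le_head h hmem))

lemma IsHallSet.exists_of_coord_ne_zero (hH : IsHallSet H le) {p : ℕ} [CharP k p] (hp : p.Prime)
    {u : MonoidAlgebra k (FreeMonoid X)} (hu : u ∈ primitives k) {w : List X} (hw0 : w ≠ [])
    (hw : (hH.basis k).coord w u ≠ 0) :
    ∃ h ∈ H, ∃ j : ℕ, hallFactor le w = List.replicate (p ^ j) h := by
  classical
  have hL := hH.isDecHall_hallFactor w
  have hf := folList_hallFactor le w
  rw [← hf] at hw
  cases hLw : hallFactor le w with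
  | nil => simp [hLw, hw0.symm] at hf
  | cons h T =>
    have hh : h ∈ H := hL.1 h (by simp [hLw])
    obtain ⟨m, b, hT, hb⟩ := hH.exists_eq_replicate_append hh (hLw ▸ hL).tail (hLw ▸ hL).le_head
    have hLm : hallFactor le w = List.replicate (m + 1) h ++ b := by
      rw [hLw, hT, List.replicate_succ, List.cons_append]
    refine ⟨h, hh, ?_⟩
    by_cases hb0 : b = []
    · subst hb0
      rw [List.append_nil] at hLm
      rw [← hLw, hLm]
      by_contra! hne
      obtain ⟨i, hi, him, hdvd⟩ := Nat.exists_not_dvd_choose hp m.succ_ne_zero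
        fun j hj => hne j (by rw [← hj])
      refine hw (hH.coord_eq_zero_of_count_ne_zero hL (a := List.replicate i h)
        (b := List.replicate (m + 1 - i) h) ?_ ?_ ?_ hu)
      · simp; omega
      · simp; omega
      · have hc := count_splits_replicate h i (m + 1 - i)
        rw [Nat.add_sub_cancel' him.le] at hc
        rwa [hLm, hc, Ne, CharP.cast_eq_zero_iff k p]
    · refine absurd (hH.coord_eq_zero_of_count_ne_zero hL (a := List.replicate (m + 1) h)
        (by simp) hb0 ?_ hu) hw
      simp [hLm, count_splits_replicate_append h (m + 1) hb]

lemma IsHallSet.length_eq_of_coord_ne_zero (hH : IsHallSet H le) {n : ℕ} {u : MonoidAlgebra k (FreeMonoid X)}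
    (hu : u ∈ Submodule.span k (word k '' {w | w.length = n})) {w : List X}
    (hw : (hH.basis k).coord w u ≠ 0) : w.length = n := by
  have h : Submodule.span k (word k '' {w | w.length = n}) ≤
      Submodule.span k (hH.basis k '' {w | w.length = n}) := by
    rw [Submodule.span_le]
    rintro _ ⟨v, hv, rfl⟩
    refine Submodule.span_mono ?_ (hH.word_mem_span_hallFactor k v)
    rintro _ ⟨v', hv', rfl⟩
    exact ⟨v', (List.Perm.length_eq hv').trans hv, hH.basis_apply k v'⟩
  exact (hH.basis k).mem_span_image.1 (h hu) (Finsupp.mem_support_iff.2 hw)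

end HallPrimitive

/-- Let `k` be a field of characteristic `p > 0`, `X` a nonempty totally ordered set, `H` a Hall
set in `X*` (given at the level of the free magma), and `n ≥ 1`.  The polynomials
`P(w)^{p^j}` with `w ∈ H`, `j ≥ 0` and `|w| p^j = n` form a `k`-basis of the degree-`n`
homogeneous component (for the total degree) of the restricted Lie subalgebra of `k⟨X⟩`
generated by `X`: they are linearly independent and span the intersection of that restricted
Lie subalgebra with the span of the words of length `n`. -/
theorem stmt_1 {X : Type*} [LinearOrder X] [Nonempty X] (k : Type*) [Field k]
    (p : ℕ) [CharP k p] (hp : p ≠ 0)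
    (H : Set (FreeMagma X)) (le : FreeMagma X → FreeMagma X → Prop) (hH : IsHallSet H le)
    (n : ℕ) (hn : 0 < n) :
    LinearIndependent k
      ((↑) : {a : MonoidAlgebra k (FreeMonoid X) //
          ∃ h ∈ H, ∃ j : ℕ, (fol h).length * p ^ j = n ∧ a = Pm k h ^ p ^ j} →
        MonoidAlgebra k (FreeMonoid X)) ∧
    Submodule.span k {a : MonoidAlgebra k (FreeMonoid X) |
        ∃ h ∈ H, ∃ j : ℕ, (fol h).length * p ^ j = n ∧ a = Pm k h ^ p ^ j} =
      restrictedClosure p k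
          (Set.range fun x : X => (MonoidAlgebra.single (FreeMonoid.of x) 1 :
            MonoidAlgebra k (FreeMonoid X))) ⊓
        Submodule.span k {a : MonoidAlgebra k (FreeMonoid X) |
          ∃ w : FreeMonoid X, (FreeMonoid.toList w).length = n ∧
            a = MonoidAlgebra.single w 1} := by
  have hp' : p.Prime := (CharP.char_is_prime_or_zero k p).resolve_right hp
  have hdec : ∀ h ∈ H, ∀ m : ℕ, IsDecHall H le (List.replicate m h) := fun h hh m =>
    ⟨fun g hg => List.eq_of_mem_replicate hg ▸ hh, List.pairwise_replicate.2 (Or.inr (hH.refl h hh))⟩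
  have hword : {a : MonoidAlgebra k (FreeMonoid X) | ∃ w : FreeMonoid X,
      (FreeMonoid.toList w).length = n ∧ a = MonoidAlgebra.single w 1} =
      word k '' {w | w.length = n} := by
    ext a
    constructor
    · rintro ⟨w, hw, rfl⟩
      exact ⟨FreeMonoid.toList w, hw, rfl⟩
    · rintro ⟨w, hw, rfl⟩
      exact ⟨FreeMonoid.ofList w, hw, rfl⟩
  rw [hword]
  refine ⟨(hH.basis k).linearIndependent.linearIndepOn_id.mono ?_, le_antisymm ?_ ?_⟩
  · rintro _ ⟨h, hh, j, -, rfl⟩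
    exact ⟨_, (hH.basis_folList k (hdec h hh (p ^ j))).trans (prodPm_replicate k _ h)⟩
  · rw [Submodule.span_le]
    rintro _ ⟨h, hh, j, hj, rfl⟩
    refine ⟨Pm_pow_mem_restrictedClosure k p h j, ?_⟩
    rw [← hj]
    exact Pm_pow_mem_span_word k h (p ^ j)
  · rintro u ⟨hu, hun⟩
    have hprim := restrictedClosure_le_primitives hp' hu
    have hsupp := ((hH.basis k).mem_span_image (s := {w | (hH.basis k).coord w u ≠ 0})).2
      fun w hw => Finsupp.mem_support_iff.1 hw
    refine Submodule.span_mono ?_ hsupp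
    rintro _ ⟨w, hw, rfl⟩
    have hlen := hH.length_eq_of_coord_ne_zero hun hw
    obtain ⟨h, hh, j, hj⟩ := hH.exists_of_coord_ne_zero hp' hprim
      (by rintro rfl; simp at hlen; omega) hw
    refine ⟨h, hh, j, ?_, by rw [hH.basis_apply k, hj, prodPm_replicate]⟩
    rw [← hlen, ← folList_hallFactor le w, hj]
    simp [folList, mul_comm]
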